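/- Let W=(w_{ij}) be a positive real m×n matrix, let R_1,…,R_p be positive real m-vectors and C_1,…,C_p be positive real n-vectors with |R_1|=…=|R_p|=|C_1|=…=|C_p|=N, let α_1,…,α_p ≥ 0 with α_1+…+α_p=1, and set R = Σ_{k=1}^p α_k R_k, C = Σ_{k=1}^p α_k C_k. Then ∫_{Mat(m,n)} f(G;R,C)^N dG ≥ ∏_{k=1}^p ( ∫_{Mat(m,n)} f(G;R_k,C_k)^N dG )^{α_k}, where dG is the exponential measure associated with W. -/

import Mathlib

open scoped BigOperators
open MeasureTheory

/-- `f(G;R,C)`: the infimum of `F(G;x,y) = ∑ i j, G i j * x i * y j` over positive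
vectors `x, y` satisfying `∏ i, x i ^ R i = 1` and `∏ j, y j ^ C j = 1`. -/
noncomputable def scalingInf {m n : ℕ} (G : Fin m → Fin n → ℝ)
    (R : Fin m → ℝ) (C : Fin n → ℝ) : ℝ :=
  sInf {z : ℝ | ∃ (x : Fin m → ℝ) (y : Fin n → ℝ),
    (∀ i, 0 < x i) ∧ (∀ j, 0 < y j) ∧
    (∏ i, x i ^ R i) = 1 ∧ (∏ j, y j ^ C j) = 1 ∧
    z = ∑ i, ∑ j, G i j * x i * y j}

/-- The exponential measure `dG` on `Mat(m,n)` associated with a positive matrix `W`: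
its density w.r.t. Lebesgue measure is `∏ i j, (W i j)⁻¹ exp (-(G i j) / W i j)` on
matrices with all entries positive, and `0` elsewhere. -/
noncomputable def expMeasure {m n : ℕ} (W : Fin m → Fin n → ℝ) :
    Measure (Fin m → Fin n → ℝ) :=
  volume.withDensity fun G =>
    ENNReal.ofReal (∏ i, ∏ j,
      if 0 < G i j then (W i j)⁻¹ * Real.exp (-(G i j) / W i j) else 0)

open scoped ENNReal Pointwise

/-- The one-dimensional Brunn–Minkowski inequality for nonempty compact sets. -/
lemma volume_add_volume_le_of_isCompact {A B C : Set ℝ} (hA : IsCompact A) (hB : IsCompact B)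
    (hAne : A.Nonempty) (hBne : B.Nonempty) (h : ∀ a ∈ A, ∀ b ∈ B, a + b ∈ C) :
    volume A + volume B ≤ volume C := by
  obtain ⟨a, ha, hamax⟩ := hA.exists_isMaxOn hAne continuousOn_id
  obtain ⟨b, hb, hbmin⟩ := hB.exists_isMinOn hBne continuousOn_id
  have hdisj : AEDisjoint volume ((fun x => x + b) '' A) ((fun x => a + x) '' B) := by
    refine measure_mono_null (t := {a + b}) ?_ (by simp)
    rintro _ ⟨⟨x, hx, rfl⟩, ⟨y, hy, hxy⟩⟩
    have h1 : x ≤ a := hamax hx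
    have h2 : b ≤ y := hbmin hy
    simp only [Set.mem_singleton_iff] at hxy ⊢
    linarith
  calc volume A + volume B
      = volume ((fun x => x + b) '' A) + volume ((fun x => a + x) '' B) := by
        simp [Set.image_add_left, Set.image_add_right]
    _ = volume ((fun x => x + b) '' A ∪ (fun x => a + x) '' B) :=
        (measure_union₀ (hB.image (by fun_prop)).measurableSet.nullMeasurableSet hdisj).symm
    _ ≤ volume C := by
        refine measure_mono ?_
        rintro _ (⟨x, hx, rfl⟩ | ⟨y, hy, rfl⟩)
        · exact h x hx b hb
        · exact h a ha y hy

/-- The one-dimensional Brunn–Minkowski inequality for nonempty measurable sets. -/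
lemma volume_add_volume_le {A B C : Set ℝ} (hA : MeasurableSet A) (hB : MeasurableSet B)
    (hAne : A.Nonempty) (hBne : B.Nonempty) (h : ∀ a ∈ A, ∀ b ∈ B, a + b ∈ C) :
    volume A + volume B ≤ volume C := by
  obtain ⟨a, ha⟩ := hAne
  obtain ⟨b, hb⟩ := hBne
  rcases eq_or_ne (volume A) 0 with hA0 | hA0
  · rw [hA0, zero_add, ← measure_preimage_add volume (-a) B]
    refine measure_mono fun x hx => ?_
    simpa using h a ha _ hx
  rcases eq_or_ne (volume B) 0 with hB0 | hB0
  · rw [hB0, add_zero, ← measure_preimage_add_right volume (-b) A]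
    refine measure_mono fun x hx => ?_
    simpa using h _ hx b hb
  refine le_of_forall_lt fun r hr => ?_
  obtain ⟨u, hu, v, hv, huv⟩ := ENNReal.exists_lt_add_of_lt_add hr hA0 hB0
  obtain ⟨K, hKA, hK, huK⟩ := hA.exists_lt_isCompact hu
  obtain ⟨L, hLB, hL, hvL⟩ := hB.exists_lt_isCompact hv
  calc r < u + v := huv
    _ ≤ volume K + volume L := add_le_add huK.le hvL.le
    _ ≤ volume C := volume_add_volume_le_of_isCompact hK hL
        (nonempty_of_measure_ne_zero (pos_of_gt huK).ne')
        (nonempty_of_measure_ne_zero (pos_of_gt hvL).ne')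
        fun a ha b hb => h a (hKA ha) b (hLB hb)

/-- The one-dimensional Brunn–Minkowski inequality for weighted Minkowski sums. -/
lemma ofReal_mul_volume_add_le {A B C : Set ℝ} (hA : MeasurableSet A) (hB : MeasurableSet B)
    (hAne : A.Nonempty) (hBne : B.Nonempty) {s t : ℝ} (hs : 0 < s) (ht : 0 < t)
    (h : ∀ a ∈ A, ∀ b ∈ B, s * a + t * b ∈ C) :
    ENNReal.ofReal s * volume A + ENNReal.ofReal t * volume B ≤ volume C := by
  have key : ∀ {r : ℝ}, 0 < r → ∀ S : Set ℝ, ENNReal.ofReal r * volume S = volume (r • S) := by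
    intro r hr S
    simp [Measure.addHaar_smul, abs_of_pos hr]
  rw [key hs, key ht]
  refine volume_add_volume_le (hA.const_smul₀ s) (hB.const_smul₀ t) (hAne.image _) (hBne.image _) ?_
  rintro _ ⟨a, ha, rfl⟩ _ ⟨b, hb, rfl⟩
  exact h a ha b hb

lemma lintegral_eq_lintegral_meas_ofReal_lt {f : ℝ → ℝ≥0∞} (hf : Measurable f)
    (hfin : ∀ x, f x ≠ ∞) :
    ∫⁻ x, f x = ∫⁻ r in Set.Ioi (0 : ℝ), volume {x | ENNReal.ofReal r < f x} := by
  have h := lintegral_eq_lintegral_meas_lt (volume : Measure ℝ) (f := fun x => (f x).toReal)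
    (.of_forall fun x => ENNReal.toReal_nonneg) hf.ennreal_toReal.aemeasurable
  simp only [ENNReal.ofReal_toReal (hfin _)] at h
  rw [h]
  refine setLIntegral_congr_fun measurableSet_Ioi fun r hr => ?_
  simp only [ENNReal.ofReal_lt_iff_lt_toReal (le_of_lt hr) (hfin _)]

lemma measurable_meas_ofReal_lt (f : ℝ → ℝ≥0∞) :
    Measurable fun r : ℝ => volume {x | ENNReal.ofReal r < f x} :=
  Antitone.measurable fun _ _ hrs =>
    measure_mono fun _ hx => (ENNReal.ofReal_le_ofReal hrs).trans_lt hx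

lemma ENNReal.geom_mean_le_arith_mean2_ofReal {s t : ℝ} (hs : 0 < s) (ht : 0 < t)
    (hst : s + t = 1) (a b : ℝ≥0∞) :
    a ^ s * b ^ t ≤ ENNReal.ofReal s * a + ENNReal.ofReal t * b := by
  have hpq : (s⁻¹).HolderConjugate t⁻¹ := by
    rw [Real.holderConjugate_iff]
    refine ⟨(one_lt_inv₀ hs).2 (by linarith), by simpa⟩
  have h := ENNReal.young_inequality (a ^ s) (b ^ t) hpq
  rw [← ENNReal.rpow_mul, ← ENNReal.rpow_mul, mul_inv_cancel₀ hs.ne', mul_inv_cancel₀ ht.ne',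
    ENNReal.rpow_one, ENNReal.rpow_one, ENNReal.ofReal_inv_of_pos hs,
    ENNReal.ofReal_inv_of_pos ht, div_eq_mul_inv, div_eq_mul_inv, inv_inv, inv_inv] at h
  rwa [mul_comm _ a, mul_comm _ b]

lemma ENNReal.min_le_rpow_mul_rpow {s t : ℝ} (hs : 0 < s) (ht : 0 < t)
    (hst : s + t = 1) (a b : ℝ≥0∞) : min a b ≤ a ^ s * b ^ t :=
  calc min a b = min a b ^ s * min a b ^ t := by
        rw [← ENNReal.rpow_add_of_nonneg _ _ hs.le ht.le, hst, ENNReal.rpow_one]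
    _ ≤ a ^ s * b ^ t := by
        gcongr
        · exact min_le_left _ _
        · exact min_le_right _ _

/-- The Prékopa–Leindler inequality on `ℝ` for functions of supremum one, in arithmetic form. -/
lemma ofReal_mul_lintegral_add_le_of_iSup_eq_one {s t : ℝ} (hs : 0 < s) (ht : 0 < t)
    {f g h : ℝ → ℝ≥0∞} (hf : Measurable f) (hg : Measurable g)
    (hh : Measurable h) (hf1 : ⨆ x, f x = 1) (hg1 : ⨆ x, g x = 1)
    (hfgh : ∀ x y, min (f x) (g y) ≤ h (s * x + t * y)) :
    ENNReal.ofReal s * (∫⁻ x, f x) + ENNReal.ofReal t * (∫⁻ x, g x) ≤ ∫⁻ x, h x := by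
  have hfle : ∀ x, f x ≤ 1 := fun x => hf1 ▸ le_iSup f x
  have hgle : ∀ x, g x ≤ 1 := fun x => hg1 ▸ le_iSup g x
  have e : ∀ u : ℝ → ℝ≥0∞, (∀ x, u x ≤ 1) → ∀ x, u x ≠ ∞ :=
    fun u hu x => ((hu x).trans_lt ENNReal.one_lt_top).ne
  calc ENNReal.ofReal s * (∫⁻ x, f x) + ENNReal.ofReal t * (∫⁻ x, g x)
      = ∫⁻ r in Set.Ioi (0 : ℝ), (ENNReal.ofReal s * volume {x | ENNReal.ofReal r < f x} +
          ENNReal.ofReal t * volume {x | ENNReal.ofReal r < g x}) := by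
        rw [lintegral_add_left ((measurable_meas_ofReal_lt f).const_mul _),
          lintegral_const_mul _ (measurable_meas_ofReal_lt f),
          lintegral_const_mul _ (measurable_meas_ofReal_lt g),
          lintegral_eq_lintegral_meas_ofReal_lt hf (e f hfle),
          lintegral_eq_lintegral_meas_ofReal_lt hg (e g hgle)]
    _ ≤ ∫⁻ r in Set.Ioi (0 : ℝ), volume {x | ENNReal.ofReal r < min (h x) 1} := by
        refine lintegral_mono fun r => ?_
        rcases lt_or_ge (ENNReal.ofReal r) 1 with hr | hr
        · refine ofReal_mul_volume_add_le (measurableSet_lt measurable_const hf)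
            (measurableSet_lt measurable_const hg) ?_ ?_ hs ht ?_
          · exact lt_iSup_iff.1 (hr.trans_eq hf1.symm)
          · exact lt_iSup_iff.1 (hr.trans_eq hg1.symm)
          · intro x hx y hy
            exact lt_min ((lt_min hx hy).trans_le (hfgh x y)) hr
        · have h1 : {x | ENNReal.ofReal r < f x} = ∅ :=
            Set.eq_empty_of_forall_notMem fun x hx => (hx.trans_le (hfle x)).not_ge hr
          have h2 : {x | ENNReal.ofReal r < g x} = ∅ :=
            Set.eq_empty_of_forall_notMem fun x hx => (hx.trans_le (hgle x)).not_ge hr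
          simp [h1, h2]
    _ = ∫⁻ x, min (h x) 1 :=
        (lintegral_eq_lintegral_meas_ofReal_lt (hh.min measurable_const)
          (e _ fun x => min_le_right _ _)).symm
    _ ≤ ∫⁻ x, h x := lintegral_mono fun x => min_le_left _ _

/-- The Prékopa–Leindler inequality on `ℝ` for bounded functions. -/
lemma lintegral_rpow_mul_lintegral_rpow_le_of_bounded {s t : ℝ} (hs : 0 < s) (ht : 0 < t)
    (hst : s + t = 1) {f g h : ℝ → ℝ≥0∞} (hf : Measurable f) (hg : Measurable g)
    (hh : Measurable h) {M : ℝ≥0∞} (hM : M ≠ ∞) (hfM : ∀ x, f x ≤ M) (hgM : ∀ x, g x ≤ M)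
    (hfgh : ∀ x y, f x ^ s * g y ^ t ≤ h (s * x + t * y)) :
    (∫⁻ x, f x) ^ s * (∫⁻ x, g x) ^ t ≤ ∫⁻ x, h x := by
  set S := ⨆ x, f x
  set T := ⨆ x, g x
  have hStop : S ≠ ∞ := ((iSup_le hfM).trans_lt hM.lt_top).ne
  have hTtop : T ≠ ∞ := ((iSup_le hgM).trans_lt hM.lt_top).ne
  rcases eq_or_ne S 0 with hS0 | hS0
  · have : ∀ x, f x = 0 := by simpa [S] using hS0
    simp [this, hs]
  rcases eq_or_ne T 0 with hT0 | hT0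
  · have : ∀ x, g x = 0 := by simpa [T] using hT0
    simp [this, ht]
  set H := S ^ s * T ^ t with hH
  have hH0 : H ≠ 0 := mul_ne_zero (by simp [hS0, hStop]) (by simp [hT0, hTtop])
  have hHtop : H ≠ ∞ := ENNReal.mul_ne_top
    (ENNReal.rpow_ne_top_of_nonneg hs.le hStop) (ENNReal.rpow_ne_top_of_nonneg ht.le hTtop)
  have hinv : ∀ a b : ℝ≥0∞, (S⁻¹ * a) ^ s * (T⁻¹ * b) ^ t = H⁻¹ * (a ^ s * b ^ t) := by
    intro a b
    rw [ENNReal.mul_rpow_of_nonneg _ _ hs.le, ENNReal.mul_rpow_of_nonneg _ _ ht.le,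
      ENNReal.inv_rpow, ENNReal.inv_rpow, hH, ENNReal.mul_inv (by simp [hS0, hStop])
      (.inl (ENNReal.rpow_ne_top_of_nonneg hs.le hStop)), mul_mul_mul_comm]
  have key := ofReal_mul_lintegral_add_le_of_iSup_eq_one hs ht
    (hf.const_mul S⁻¹) (hg.const_mul T⁻¹) (hh.const_mul H⁻¹)
    (by rw [← ENNReal.mul_iSup, ENNReal.inv_mul_cancel hS0 hStop])
    (by rw [← ENNReal.mul_iSup, ENNReal.inv_mul_cancel hT0 hTtop])
    (fun x y => (ENNReal.min_le_rpow_mul_rpow hs ht hst _ _).trans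
      ((hinv _ _).trans_le (by gcongr; exact hfgh x y)))
  rw [lintegral_const_mul _ hf, lintegral_const_mul _ hg, lintegral_const_mul _ hh] at key
  have h2 := (ENNReal.geom_mean_le_arith_mean2_ofReal hs ht hst _ _).trans key
  rw [hinv] at h2
  exact (ENNReal.mul_le_mul_iff_right (ENNReal.inv_ne_zero.2 hHtop) (ENNReal.inv_ne_top.2 hH0)).1 h2

/-- The Prékopa–Leindler inequality holds on the measure space `E`. -/
def SatisfiesPrekopaLeindler (E : Type*) [MeasureSpace E] [AddCommGroup E] [Module ℝ E] : Prop :=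
  ∀ ⦃s t : ℝ⦄, 0 < s → 0 < t → s + t = 1 → ∀ ⦃f g h : E → ℝ≥0∞⦄, Measurable f → Measurable g →
    Measurable h → (∀ x y, f x ^ s * g y ^ t ≤ h (s • x + t • y)) →
      (∫⁻ x, f x) ^ s * (∫⁻ x, g x) ^ t ≤ ∫⁻ x, h x

lemma satisfiesPrekopaLeindler_real : SatisfiesPrekopaLeindler ℝ := by
  intro s t hs ht hst f g h hf hg hh hfgh
  have hlim : ∀ u : ℝ → ℝ≥0∞, Measurable u →
      Filter.Tendsto (fun n : ℕ => ∫⁻ x, min (u x) n) Filter.atTop (nhds (∫⁻ x, u x)) := by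
    intro u hu
    refine lintegral_tendsto_of_tendsto_of_monotone
      (fun n => (hu.min measurable_const).aemeasurable)
      (.of_forall fun x m n hmn => min_le_min_left _ (by exact_mod_cast hmn))
      (.of_forall fun x => ?_)
    simpa using tendsto_const_nhds.min ENNReal.tendsto_nat_nhds_top
  rcases eq_or_ne (∫⁻ x, f x) 0 with hf0 | hf0
  · simp [hf0, hs]
  rcases eq_or_ne (∫⁻ x, g x) 0 with hg0 | hg0
  · simp [hg0, ht]
  have hpow0 : ∀ {a : ℝ≥0∞} {r : ℝ}, a ≠ 0 → 0 < r → a ^ r ≠ 0 := fun ha hr =>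
    (ENNReal.rpow_pos_of_nonneg (pos_iff_ne_zero.2 ha) hr.le).ne'
  refine le_of_tendsto (ENNReal.Tendsto.mul ((hlim f hf).ennrpow_const s) (.inl (hpow0 hf0 hs))
    ((hlim g hg).ennrpow_const t) (.inl (hpow0 hg0 ht))) (.of_forall fun n => ?_)
  refine lintegral_rpow_mul_lintegral_rpow_le_of_bounded hs ht hst (hf.min measurable_const)
    (hg.min measurable_const) hh (ENNReal.natCast_ne_top n) (fun x => min_le_right _ _)
    (fun x => min_le_right _ _) fun x y => ?_
  refine le_trans ?_ (hfgh x y)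
  gcongr <;> exact min_le_left _ _

lemma SatisfiesPrekopaLeindler.prod {E F : Type*} [MeasureSpace E] [AddCommGroup E] [Module ℝ E]
    [MeasureSpace F] [AddCommGroup F] [Module ℝ F] [SFinite (volume : Measure F)]
    (hE : SatisfiesPrekopaLeindler E) (hF : SatisfiesPrekopaLeindler F) :
    SatisfiesPrekopaLeindler (E × F) := by
  intro s t hs ht hst f g h hf hg hh hfgh
  rw [Measure.volume_eq_prod, lintegral_prod _ hf.aemeasurable, lintegral_prod _ hg.aemeasurable,
    lintegral_prod _ hh.aemeasurable]
  refine hE hs ht hst hf.lintegral_prod_right' hg.lintegral_prod_right' hh.lintegral_prod_right' ?_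
  intro x y
  exact hF hs ht hst (hf.comp measurable_prodMk_left) (hg.comp measurable_prodMk_left)
    (hh.comp measurable_prodMk_left) fun u v => hfgh (x, u) (y, v)

lemma SatisfiesPrekopaLeindler.pi_fin {E : Type*} [MeasureSpace E] [AddCommGroup E] [Module ℝ E]
    [SigmaFinite (volume : Measure E)] (hE : SatisfiesPrekopaLeindler E) (n : ℕ) :
    SatisfiesPrekopaLeindler (Fin n → E) := by
  induction n with
  | zero =>
    intro s t hs ht hst f g h hf hg hh hfgh
    have hvol : (volume : Measure (Fin 0 → E)) Set.univ = 1 := by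
      rw [← Set.pi_univ Set.univ, volume_pi_pi]
      simp
    simpa [lintegral_unique, hvol, Subsingleton.elim _ (default : Fin 0 → E)]
      using hfgh default default
  | succ n ih =>
    intro s t hs ht hst f g h hf hg hh hfgh
    let e := MeasurableEquiv.piFinSuccAbove (fun _ : Fin (n + 1) => E) 0
    have he : MeasurePreserving e.symm volume volume :=
      (volume_preserving_piFinSuccAbove (fun _ : Fin (n + 1) => E) 0).symm
    rw [← he.lintegral_comp hf, ← he.lintegral_comp hg, ← he.lintegral_comp hh]
    refine hE.prod ih hs ht hst (hf.comp e.symm.measurable) (hg.comp e.symm.measurable)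
      (hh.comp e.symm.measurable) fun x y => (hfgh _ _).trans_eq (congrArg h ?_)
    ext i
    refine Fin.cases ?_ (fun j => ?_) i <;>
      simp [e, MeasurableEquiv.piFinSuccAbove, Fin.insertNthEquiv]

lemma SatisfiesPrekopaLeindler.integral_rpow_mul_integral_rpow_le {E : Type*} [MeasureSpace E]
    [AddCommGroup E] [Module ℝ E] (hE : SatisfiesPrekopaLeindler E) {s t : ℝ} (hs : 0 < s)
    (ht : 0 < t) (hst : s + t = 1) {f g h : E → ℝ} (hf : Measurable f) (hg : Measurable g)
    (hh : Measurable h) (hf0 : ∀ x, 0 ≤ f x) (hg0 : ∀ x, 0 ≤ g x) (hh0 : ∀ x, 0 ≤ h x)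
    (hhi : Integrable h) (hfgh : ∀ x y, f x ^ s * g y ^ t ≤ h (s • x + t • y)) :
    (∫ x, f x) ^ s * (∫ x, g x) ^ t ≤ ∫ x, h x := by
  have key := hE hs ht hst hf.ennreal_ofReal hg.ennreal_ofReal hh.ennreal_ofReal fun x y => by
    rw [ENNReal.ofReal_rpow_of_nonneg (hf0 x) hs.le, ENNReal.ofReal_rpow_of_nonneg (hg0 y) ht.le,
      ← ENNReal.ofReal_mul (Real.rpow_nonneg (hf0 x) s)]
    exact ENNReal.ofReal_le_ofReal (hfgh x y)
  have hfin : ∫⁻ x, ENNReal.ofReal (h x) ≠ ∞ := hhi.lintegral_lt_top.ne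
  rw [integral_eq_lintegral_of_nonneg_ae (.of_forall hf0) hf.aestronglyMeasurable,
    integral_eq_lintegral_of_nonneg_ae (.of_forall hg0) hg.aestronglyMeasurable,
    integral_eq_lintegral_of_nonneg_ae (.of_forall hh0) hh.aestronglyMeasurable,
    ENNReal.toReal_rpow, ENNReal.toReal_rpow, ← ENNReal.toReal_mul]
  exact ENNReal.toReal_mono hfin key

/-- A nonnegative function satisfying the two-point multiplicative concavity inequality on a convex
set satisfies its multi-point version. -/
lemma prod_rpow_le_of_rpow_mul_rpow_le {E ι : Type*} [AddCommGroup E] [Module ℝ E] {D : Set E}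
    (hD : Convex ℝ D) {Φ : E → ℝ} (hΦ : ∀ x ∈ D, 0 ≤ Φ x)
    (h : ∀ x ∈ D, ∀ y ∈ D, ∀ s t : ℝ, 0 < s → 0 < t → s + t = 1 →
      Φ x ^ s * Φ y ^ t ≤ Φ (s • x + t • y))
    (u : Finset ι) {α : ι → ℝ} {p : ι → E} (hα : ∀ k ∈ u, 0 ≤ α k) (hα1 : ∑ k ∈ u, α k = 1)
    (hp : ∀ k ∈ u, p k ∈ D) :
    ∏ k ∈ u, Φ (p k) ^ α k ≤ Φ (∑ k ∈ u, α k • p k) := by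
  by_cases hz : ∃ k ∈ u, α k ≠ 0 ∧ Φ (p k) = 0
  · obtain ⟨k, hk, hαk, hΦk⟩ := hz
    rw [Finset.prod_eq_zero hk (by rw [hΦk, Real.zero_rpow hαk])]
    exact hΦ _ (hD.sum_mem hα hα1 hp)
  push Not at hz
  have hconv : ConcaveOn ℝ {x ∈ D | 0 < Φ x} fun x => Real.log (Φ x) := by
    have hpos : ∀ x ∈ {x ∈ D | 0 < Φ x}, ∀ y ∈ {x ∈ D | 0 < Φ x}, ∀ s t : ℝ, 0 < s → 0 < t →
        s + t = 1 → 0 < Φ x ^ s * Φ y ^ t := fun x hx y hy s t _ _ _ =>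
      mul_pos (Real.rpow_pos_of_pos hx.2 s) (Real.rpow_pos_of_pos hy.2 t)
    refine ⟨convex_iff_forall_pos.2 fun x hx y hy s t hs ht hst => ⟨hD hx.1 hy.1 hs.le ht.le hst,
      (hpos x hx y hy s t hs ht hst).trans_le (h x hx.1 y hy.1 s t hs ht hst)⟩, ?_⟩
    intro x hx y hy s t hs ht hst
    rcases hs.eq_or_lt with rfl | hs
    · obtain rfl : t = 1 := by linarith
      simp
    rcases ht.eq_or_lt with rfl | ht
    · obtain rfl : s = 1 := by linarith
      simp
    have := Real.log_le_log (hpos x hx y hy s t hs ht hst) (h x hx.1 y hy.1 s t hs ht hst)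
    rwa [Real.log_mul (Real.rpow_pos_of_pos hx.2 s).ne' (Real.rpow_pos_of_pos hy.2 t).ne',
      Real.log_rpow hx.2, Real.log_rpow hy.2] at this
  set v := u.filter (α · ≠ 0) with hv
  have hvu : ∀ k ∈ v, k ∈ u := fun k hk => (Finset.mem_filter.1 hk).1
  have hpv : ∀ k ∈ v, p k ∈ {x ∈ D | 0 < Φ x} := fun k hk =>
    ⟨hp k (hvu k hk), (hΦ _ (hp k (hvu k hk))).lt_of_ne'
      (hz k (hvu k hk) (Finset.mem_filter.1 hk).2)⟩
  have hα1v : ∑ k ∈ v, α k = 1 := by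
    rw [hv, Finset.sum_filter_of_ne fun k _ h => h, hα1]
  have hsum : ∑ k ∈ v, α k • p k = ∑ k ∈ u, α k • p k :=
    Finset.sum_filter_of_ne fun k _ h h0 => h (by rw [h0, zero_smul])
  have hprod : ∏ k ∈ v, Φ (p k) ^ α k = ∏ k ∈ u, Φ (p k) ^ α k :=
    Finset.prod_filter_of_ne fun k _ h h0 => h (by rw [h0, Real.rpow_zero])
  have hαv : ∀ k ∈ v, 0 ≤ α k := fun k hk => hα k (hvu k hk)
  have key := hconv.le_map_sum hαv hα1v hpv
  have hmem := hconv.1.sum_mem hαv hα1v hpv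
  rw [← hsum, ← hprod, ← Real.log_le_log_iff
    (Finset.prod_pos fun k hk => Real.rpow_pos_of_pos (hpv k hk).2 _) hmem.2,
    Real.log_prod fun k hk => (Real.rpow_pos_of_pos (hpv k hk).2 _).ne']
  refine le_trans (le_of_eq (Finset.sum_congr rfl fun k hk => ?_)) key
  rw [Real.log_rpow (hpv k hk).2, smul_eq_mul]

section scalingInf

variable {m n : ℕ} {G G' : Fin m → Fin n → ℝ} {R R' : Fin m → ℝ} {C C' : Fin n → ℝ}

lemma scalingInf_nonneg (hG : ∀ i j, 0 ≤ G i j) : 0 ≤ scalingInf G R C := by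
  refine Real.sInf_nonneg ?_
  rintro _ ⟨x, y, hx, hy, -, -, rfl⟩
  exact Finset.sum_nonneg fun i _ => Finset.sum_nonneg fun j _ =>
    mul_nonneg (mul_nonneg (hG i j) (hx i).le) (hy j).le

lemma bddBelow_scalingInf_set (hG : ∀ i j, 0 ≤ G i j) :
    BddBelow {z : ℝ | ∃ (x : Fin m → ℝ) (y : Fin n → ℝ),
      (∀ i, 0 < x i) ∧ (∀ j, 0 < y j) ∧
      (∏ i, x i ^ R i) = 1 ∧ (∏ j, y j ^ C j) = 1 ∧
      z = ∑ i, ∑ j, G i j * x i * y j} := by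
  refine ⟨0, ?_⟩
  rintro _ ⟨x, y, hx, hy, -, -, rfl⟩
  exact Finset.sum_nonneg fun i _ => Finset.sum_nonneg fun j _ =>
    mul_nonneg (mul_nonneg (hG i j) (hx i).le) (hy j).le

lemma nonempty_scalingInf_set (G : Fin m → Fin n → ℝ) (R : Fin m → ℝ) (C : Fin n → ℝ) :
    {z : ℝ | ∃ (x : Fin m → ℝ) (y : Fin n → ℝ),
      (∀ i, 0 < x i) ∧ (∀ j, 0 < y j) ∧
      (∏ i, x i ^ R i) = 1 ∧ (∏ j, y j ^ C j) = 1 ∧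
      z = ∑ i, ∑ j, G i j * x i * y j}.Nonempty :=
  ⟨_, 1, 1, by simp, by simp, by simp, by simp, rfl⟩

lemma scalingInf_le (hG : ∀ i j, 0 ≤ G i j) {x : Fin m → ℝ} {y : Fin n → ℝ}
    (hx : ∀ i, 0 < x i) (hy : ∀ j, 0 < y j) (hxR : ∏ i, x i ^ R i = 1)
    (hyC : ∏ j, y j ^ C j = 1) : scalingInf G R C ≤ ∑ i, ∑ j, G i j * x i * y j :=
  csInf_le (bddBelow_scalingInf_set hG) ⟨x, y, hx, hy, hxR, hyC, rfl⟩

lemma prod_rpow_normalized {ι : Type*} [Fintype ι] {x r : ι → ℝ} {N : ℝ} (hN : 0 < N)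
    (hr : ∑ i, r i = N) (hx : ∀ i, 0 < x i) :
    ∏ i, ((∏ k, x k ^ r k) ^ (-N⁻¹) * x i) ^ r i = 1 := by
  have ha : 0 < ∏ k, x k ^ r k := Finset.prod_pos fun k _ => Real.rpow_pos_of_pos (hx k) _
  set a := ∏ k, x k ^ r k
  calc ∏ i, (a ^ (-N⁻¹) * x i) ^ r i
      = ∏ i, ((a ^ (-N⁻¹)) ^ r i * x i ^ r i) :=
        Finset.prod_congr rfl fun i _ => Real.mul_rpow (Real.rpow_nonneg ha.le _) (hx i).le
    _ = (a ^ (-N⁻¹)) ^ N * a := by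
        rw [Finset.prod_mul_distrib, ← Real.rpow_sum_of_pos (Real.rpow_pos_of_pos ha _), hr]
    _ = 1 := by
        rw [← Real.rpow_mul ha.le, neg_mul, inv_mul_cancel₀ hN.ne', Real.rpow_neg_one,
          inv_mul_cancel₀ (ne_of_gt ha)]

/-- The lower bound on the bilinear form at vectors which need not satisfy the normalization. -/
lemma rpow_mul_scalingInf_le (hG : ∀ i j, 0 ≤ G i j) {N : ℝ} (hN : 0 < N)
    (hR : ∑ i, R i = N) (hC : ∑ j, C j = N) {x : Fin m → ℝ} {y : Fin n → ℝ}
    (hx : ∀ i, 0 < x i) (hy : ∀ j, 0 < y j) :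
    ((∏ i, x i ^ R i) * ∏ j, y j ^ C j) ^ N⁻¹ * scalingInf G R C ≤
      ∑ i, ∑ j, G i j * x i * y j := by
  have ha : 0 < ∏ k, x k ^ R k := Finset.prod_pos fun k _ => Real.rpow_pos_of_pos (hx k) _
  have hb : 0 < ∏ k, y k ^ C k := Finset.prod_pos fun k _ => Real.rpow_pos_of_pos (hy k) _
  have h := scalingInf_le hG (fun i => mul_pos (Real.rpow_pos_of_pos ha (-N⁻¹)) (hx i))
    (fun j => mul_pos (Real.rpow_pos_of_pos hb (-N⁻¹)) (hy j))
    (prod_rpow_normalized hN hR hx) (prod_rpow_normalized hN hC hy)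
  set a := ∏ k, x k ^ R k
  set b := ∏ k, y k ^ C k
  have hsum : ∑ i, ∑ j, G i j * (a ^ (-N⁻¹) * x i) * (b ^ (-N⁻¹) * y j) =
      ((a * b) ^ N⁻¹)⁻¹ * ∑ i, ∑ j, G i j * x i * y j := by
    simp only [Finset.mul_sum]
    refine Finset.sum_congr rfl fun i _ => Finset.sum_congr rfl fun j _ => ?_
    rw [Real.rpow_neg ha.le, Real.rpow_neg hb.le, Real.mul_rpow ha.le hb.le, mul_inv]
    ring
  rw [hsum] at h
  rwa [le_inv_mul_iff₀ (Real.rpow_pos_of_pos (mul_pos ha hb) _)] at h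

lemma prod_rpow_add_mul {ι : Type*} [Fintype ι] {x : ι → ℝ} (hx : ∀ i, 0 < x i) (r r' : ι → ℝ)
    (s t : ℝ) : ∏ i, x i ^ (s • r + t • r') i = (∏ i, x i ^ r i) ^ s * (∏ i, x i ^ r' i) ^ t := by
  rw [← Real.finsetProd_rpow _ _ fun i _ => Real.rpow_nonneg (hx i).le _,
    ← Real.finsetProd_rpow _ _ fun i _ => Real.rpow_nonneg (hx i).le _, ← Finset.prod_mul_distrib]
  refine Finset.prod_congr rfl fun i _ => ?_
  rw [← Real.rpow_mul (hx i).le, ← Real.rpow_mul (hx i).le, ← Real.rpow_add (hx i)]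
  simp [mul_comm]

/-- `scalingInf` is log-concave jointly in all its arguments. -/
lemma scalingInf_rpow_mul_rpow_le (hG : ∀ i j, 0 ≤ G i j) (hG' : ∀ i j, 0 ≤ G' i j) {N : ℝ}
    (hN : 0 < N) (hR : ∑ i, R i = N) (hC : ∑ j, C j = N) (hR' : ∑ i, R' i = N)
    (hC' : ∑ j, C' j = N) {s t : ℝ} (hs : 0 ≤ s) (ht : 0 ≤ t) (hst : s + t = 1) :
    scalingInf G R C ^ s * scalingInf G' R' C' ^ t ≤
      scalingInf (s • G + t • G') (s • R + t • R') (s • C + t • C') := by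
  refine le_csInf (nonempty_scalingInf_set _ _ _) ?_
  rintro _ ⟨x, y, hx, hy, hxR, hyC, rfl⟩
  rw [prod_rpow_add_mul hx] at hxR
  rw [prod_rpow_add_mul hy] at hyC
  have hpos : ∀ {l : ℕ} (z r : Fin l → ℝ), (∀ k, 0 < z k) → 0 < ∏ k, z k ^ r k :=
    fun z r hz => Finset.prod_pos fun k _ => Real.rpow_pos_of_pos (hz k) _
  have h1 := rpow_mul_scalingInf_le hG hN hR hC hx hy
  have h2 := rpow_mul_scalingInf_le hG' hN hR' hC' hx hy
  have ha := hpos x R hx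
  have ha' := hpos x R' hx
  have hb := hpos y C hy
  have hb' := hpos y C' hy
  have hf := scalingInf_nonneg (R := R) (C := C) hG
  have hf' := scalingInf_nonneg (R := R') (C := C') hG'
  set a := ∏ k, x k ^ R k
  set a' := ∏ k, x k ^ R' k
  set b := ∏ k, y k ^ C k
  set b' := ∏ k, y k ^ C' k
  have hab : 0 < (a * b) ^ N⁻¹ := Real.rpow_pos_of_pos (mul_pos ha hb) _
  have hab' : 0 < (a' * b') ^ N⁻¹ := Real.rpow_pos_of_pos (mul_pos ha' hb') _
  have hone : ((a * b) ^ N⁻¹) ^ s * ((a' * b') ^ N⁻¹) ^ t = 1 := by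
    rw [← Real.rpow_mul (mul_pos ha hb).le, ← Real.rpow_mul (mul_pos ha' hb').le,
      mul_comm N⁻¹, mul_comm N⁻¹, Real.rpow_mul (mul_pos ha hb).le,
      Real.rpow_mul (mul_pos ha' hb').le, ← Real.mul_rpow (by positivity) (by positivity),
      Real.mul_rpow ha.le hb.le, Real.mul_rpow ha'.le hb'.le, mul_mul_mul_comm, hxR, hyC,
      one_mul, Real.one_rpow]
  calc scalingInf G R C ^ s * scalingInf G' R' C' ^ t
      = ((a * b) ^ N⁻¹ * scalingInf G R C) ^ s * ((a' * b') ^ N⁻¹ * scalingInf G' R' C') ^ t := by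
        rw [Real.mul_rpow hab.le hf, Real.mul_rpow hab'.le hf', mul_mul_mul_comm, hone, one_mul]
    _ ≤ s * ((a * b) ^ N⁻¹ * scalingInf G R C) + t * ((a' * b') ^ N⁻¹ * scalingInf G' R' C') :=
        Real.geom_mean_le_arith_mean2_weighted hs ht (mul_nonneg hab.le hf)
          (mul_nonneg hab'.le hf') hst
    _ ≤ s * (∑ i, ∑ j, G i j * x i * y j) + t * ∑ i, ∑ j, G' i j * x i * y j := by gcongr
    _ = ∑ i, ∑ j, (s • G + t • G') i j * x i * y j := by
        simp only [Finset.mul_sum, ← Finset.sum_add_distrib]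
        refine Finset.sum_congr rfl fun i _ => Finset.sum_congr rfl fun j _ => ?_
        simp only [Pi.add_apply, Pi.smul_apply, smul_eq_mul]
        ring

lemma rpow_scalingInf_rpow_mul_rpow_le (hG : ∀ i j, 0 ≤ G i j) (hG' : ∀ i j, 0 ≤ G' i j) {N : ℝ}
    (hN : 0 ≤ N) (hR : ∑ i, R i = N) (hC : ∑ j, C j = N) (hR' : ∑ i, R' i = N)
    (hC' : ∑ j, C' j = N) {s t : ℝ} (hs : 0 ≤ s) (ht : 0 ≤ t) (hst : s + t = 1) :
    (scalingInf G R C ^ N) ^ s * (scalingInf G' R' C' ^ N) ^ t ≤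
      scalingInf (s • G + t • G') (s • R + t • R') (s • C + t • C') ^ N := by
  rcases hN.eq_or_lt with rfl | hN
  · simp
  have hf := scalingInf_nonneg (R := R) (C := C) hG
  have hf' := scalingInf_nonneg (R := R') (C := C') hG'
  rw [← Real.rpow_mul hf, ← Real.rpow_mul hf', mul_comm N, mul_comm N, Real.rpow_mul hf,
    Real.rpow_mul hf', ← Real.mul_rpow (by positivity) (by positivity)]
  exact Real.rpow_le_rpow (by positivity)
    (scalingInf_rpow_mul_rpow_le hG hG' hN hR hC hR' hC' hs ht hst) hN.le

/-- The set of matrices with positive entries. -/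
def positiveMatrices (m n : ℕ) : Set (Fin m → Fin n → ℝ) := {G | ∀ i j, 0 < G i j}

lemma isOpen_positiveMatrices : IsOpen (positiveMatrices m n) := by
  simp only [positiveMatrices, Set.ofPred_forall]
  exact isOpen_iInter_of_finite fun i => isOpen_iInter_of_finite fun j =>
    isOpen_lt continuous_const (by fun_prop)

lemma measurable_indicator_scalingInf (R : Fin m → ℝ) (C : Fin n → ℝ) :
    Measurable ((positiveMatrices m n).indicator fun G => scalingInf G R C) := by
  refine measurable_of_restrict_of_restrict_compl (s := positiveMatrices m n)
    isOpen_positiveMatrices.measurableSet ?_ ?_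
  · have hres : (positiveMatrices m n).domRestrict
        ((positiveMatrices m n).indicator fun G => scalingInf G R C) =
          (positiveMatrices m n).domRestrict fun G => scalingInf G R C :=
      funext fun G => Set.indicator_of_mem G.2 _
    rw [hres]
    refine measurable_of_Iio fun c => IsOpen.measurableSet ?_
    have : (positiveMatrices m n).domRestrict (fun G => scalingInf G R C) ⁻¹' Set.Iio c =
        ⋃ (x : Fin m → ℝ) (y : Fin n → ℝ) (_ : (∀ i, 0 < x i) ∧ (∀ j, 0 < y j) ∧
          ∏ i, x i ^ R i = 1 ∧ ∏ j, y j ^ C j = 1),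
          {G : positiveMatrices m n | ∑ i, ∑ j, (G : Fin m → Fin n → ℝ) i j * x i * y j < c} := by
      ext G
      simp only [Set.mem_preimage, Set.domRestrict_apply, Set.mem_Iio, Set.mem_iUnion,
        Set.mem_ofPred_eq, scalingInf]
      rw [csInf_lt_iff (bddBelow_scalingInf_set fun i j => (G.2 i j).le)
        (nonempty_scalingInf_set _ _ _)]
      constructor
      · rintro ⟨_, ⟨x, y, hx, hy, hxR, hyC, rfl⟩, hlt⟩
        exact ⟨x, y, ⟨hx, hy, hxR, hyC⟩, hlt⟩
      · rintro ⟨x, y, ⟨hx, hy, hxR, hyC⟩, hlt⟩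
        exact ⟨_, ⟨x, y, hx, hy, hxR, hyC, rfl⟩, hlt⟩
    rw [this]
    refine isOpen_iUnion fun x => isOpen_iUnion fun y => isOpen_iUnion fun _ => ?_
    have hcont : Continuous fun G : Fin m → Fin n → ℝ => ∑ i, ∑ j, G i j * x i * y j := by
      fun_prop
    exact isOpen_lt (hcont.comp continuous_subtype_val) continuous_const
  · have hres : (positiveMatrices m n)ᶜ.domRestrict
        ((positiveMatrices m n).indicator fun G => scalingInf G R C) = fun _ => 0 :=
      funext fun G => Set.indicator_of_notMem G.2 _
    rw [hres]
    exact measurable_const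

/-- The density of `expMeasure W`. -/
noncomputable def expDensity (W G : Fin m → Fin n → ℝ) : ℝ :=
  ∏ i, ∏ j, if 0 < G i j then (W i j)⁻¹ * Real.exp (-(G i j) / W i j) else 0

lemma measurable_expDensity (W : Fin m → Fin n → ℝ) : Measurable (expDensity W) := by
  unfold expDensity
  refine Finset.measurable_fun_prod _ fun i _ => Finset.measurable_fun_prod _ fun j _ =>
    Measurable.ite (measurableSet_lt measurable_const (by fun_prop)) (by fun_prop) measurable_const

lemma expDensity_nonneg {W : Fin m → Fin n → ℝ} (hW : ∀ i j, 0 < W i j) (G : Fin m → Fin n → ℝ) :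
    0 ≤ expDensity W G := by
  refine Finset.prod_nonneg fun i _ => Finset.prod_nonneg fun j _ => ?_
  have := hW i j
  split_ifs <;> positivity

lemma expDensity_of_notMem (W : Fin m → Fin n → ℝ) (hG : G ∉ positiveMatrices m n) :
    expDensity W G = 0 := by
  simp only [positiveMatrices, Set.mem_ofPred_eq, not_forall] at hG
  obtain ⟨i, j, hij⟩ := hG
  exact Finset.prod_eq_zero (Finset.mem_univ i)
    (Finset.prod_eq_zero (Finset.mem_univ j) (if_neg hij))

lemma expDensity_smul_add_smul {W : Fin m → Fin n → ℝ} (hW : ∀ i j, 0 < W i j)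
    (hG : G ∈ positiveMatrices m n) (hG' : G' ∈ positiveMatrices m n) {s t : ℝ} (hs : 0 < s)
    (ht : 0 < t) (hst : s + t = 1) :
    expDensity W (s • G + t • G') = expDensity W G ^ s * expDensity W G' ^ t := by
  have h : ∀ H ∈ positiveMatrices m n, expDensity W H =
      Real.exp (∑ i, ∑ j, (-Real.log (W i j) - H i j / W i j)) := by
    intro H hH
    simp only [expDensity, Real.exp_sum, if_pos (hH _ _)]
    refine Finset.prod_congr rfl fun i _ => Finset.prod_congr rfl fun j _ => ?_
    rw [sub_eq_add_neg, Real.exp_add, Real.exp_neg (Real.log _), Real.exp_log (hW i j), neg_div]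
  rw [h _ hG, h _ hG', h (s • G + t • G') fun i j => add_pos (mul_pos hs (hG i j)) (mul_pos ht (hG' i j)),
    ← Real.exp_mul, ← Real.exp_mul, ← Real.exp_add]
  simp only [Finset.sum_mul, ← Finset.sum_add_distrib]
  congr 1
  refine Finset.sum_congr rfl fun i _ => Finset.sum_congr rfl fun j _ => ?_
  simp only [Pi.add_apply, Pi.smul_apply, smul_eq_mul]
  linear_combination Real.log (W i j) * hst

lemma measurable_expDensity_mul_rpow (W : Fin m → Fin n → ℝ) (R : Fin m → ℝ) (C : Fin n → ℝ)
    (N : ℝ) : Measurable fun G => expDensity W G * scalingInf G R C ^ N := by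
  have : (fun G => expDensity W G * scalingInf G R C ^ N) = fun G => expDensity W G *
      (positiveMatrices m n).indicator (fun G => scalingInf G R C) G ^ N := by
    ext G
    by_cases hG : G ∈ positiveMatrices m n
    · rw [Set.indicator_of_mem hG]
    · simp [expDensity_of_notMem W hG]
  rw [this]
  exact (measurable_expDensity W).mul ((measurable_indicator_scalingInf R C).pow_const N)

lemma expDensity_mul_rpow_nonneg {W : Fin m → Fin n → ℝ} (hW : ∀ i j, 0 < W i j) (R : Fin m → ℝ)
    (C : Fin n → ℝ) (N : ℝ) (G : Fin m → Fin n → ℝ) :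
    0 ≤ expDensity W G * scalingInf G R C ^ N := by
  by_cases hG : G ∈ positiveMatrices m n
  · exact mul_nonneg (expDensity_nonneg hW G)
      (Real.rpow_nonneg (scalingInf_nonneg fun i j => (hG i j).le) N)
  · simp [expDensity_of_notMem W hG]

lemma integral_expMeasure {W : Fin m → Fin n → ℝ} (hW : ∀ i j, 0 < W i j)
    (f : (Fin m → Fin n → ℝ) → ℝ) :
    ∫ G, f G ∂(expMeasure W) = ∫ G, expDensity W G * f G := by
  have : expMeasure W = volume.withDensity fun G => ENNReal.ofReal (expDensity W G) := rfl
  rw [this, integral_withDensity_eq_integral_toReal_smul (measurable_expDensity W).ennreal_ofReal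
    (.of_forall fun _ => ENNReal.ofReal_lt_top)]
  simp only [ENNReal.toReal_ofReal (expDensity_nonneg hW _), smul_eq_mul]

lemma exists_rpow_le_mul_exp {N ε : ℝ} (hN : 0 ≤ N) (hε : 0 < ε) :
    ∃ K : ℝ, 0 ≤ K ∧ ∀ x : ℝ, 0 ≤ x → x ^ N ≤ K * Real.exp (ε * x) := by
  rcases hN.eq_or_lt with rfl | hN
  · exact ⟨1, zero_le_one, fun x hx => by simpa using mul_nonneg hε.le hx⟩
  refine ⟨(N / ε) ^ N, by positivity, fun x hx => ?_⟩
  have h1 : x ≤ N / ε * Real.exp (ε * x / N) := by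
    have h2 := Real.add_one_le_exp (ε * x / N)
    calc x = N / ε * (ε * x / N) := by field_simp
      _ ≤ N / ε * Real.exp (ε * x / N) := by gcongr; linarith
  calc x ^ N ≤ (N / ε * Real.exp (ε * x / N)) ^ N := Real.rpow_le_rpow hx h1 hN.le
    _ = (N / ε) ^ N * Real.exp (ε * x) := by
        rw [Real.mul_rpow (by positivity) (Real.exp_pos _).le, ← Real.exp_mul,
          div_mul_cancel₀ _ hN.ne']

lemma integrable_ite_mul_exp_neg {a b : ℝ} (hb : 0 < b) :
    Integrable fun g : ℝ => if 0 < g then a * Real.exp (-b * g) else 0 := by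
  have h : IntegrableOn (fun g : ℝ => a * Real.exp (-b * g)) (Set.Ioi 0) :=
    (exp_neg_integrableOn_Ioi 0 hb).const_mul a
  exact (integrable_indicator_iff measurableSet_Ioi).2 h

lemma integrable_expDensity_mul_rpow {W : Fin m → Fin n → ℝ} (hW : ∀ i j, 0 < W i j)
    (R : Fin m → ℝ) (C : Fin n → ℝ) {N : ℝ} (hN : 0 ≤ N) :
    Integrable fun G => expDensity W G * scalingInf G R C ^ N := by
  obtain ⟨ε, hε, hεW⟩ : ∃ ε : ℝ, 0 < ε ∧ ∀ i j, ε < (W i j)⁻¹ := by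
    have hpos : 0 < 1 + ∑ i, ∑ j, W i j := add_pos_of_pos_of_nonneg one_pos
      (Finset.sum_nonneg fun i _ => Finset.sum_nonneg fun j _ => (hW i j).le)
    refine ⟨(1 + ∑ i, ∑ j, W i j)⁻¹, inv_pos.2 hpos, fun i j => ?_⟩
    refine inv_strictAnti₀ (hW i j) ?_
    have h1 : W i j ≤ ∑ j, W i j :=
      Finset.single_le_sum (fun j _ => (hW i j).le) (Finset.mem_univ j)
    have h2 : ∑ j, W i j ≤ ∑ i, ∑ j, W i j :=
      Finset.single_le_sum (f := fun i => ∑ j, W i j)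
        (fun i _ => Finset.sum_nonneg fun j _ => (hW i j).le) (Finset.mem_univ i)
    linarith
  obtain ⟨K, hK, hKN⟩ := exists_rpow_le_mul_exp hN hε
  have hint : Integrable fun G : Fin m → Fin n → ℝ => K * ∏ i, ∏ j,
      if 0 < G i j then (W i j)⁻¹ * Real.exp (-((W i j)⁻¹ - ε) * G i j) else 0 := by
    refine Integrable.const_mul ?_ K
    refine Integrable.fintype_prod (f := fun i (g : Fin n → ℝ) => ∏ j,
      if 0 < g j then (W i j)⁻¹ * Real.exp (-((W i j)⁻¹ - ε) * g j) else 0) fun i => ?_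
    exact Integrable.fintype_prod (f := fun j (g : ℝ) =>
      if 0 < g then (W i j)⁻¹ * Real.exp (-((W i j)⁻¹ - ε) * g) else 0) fun j =>
      integrable_ite_mul_exp_neg (sub_pos.2 (hεW i j))
  refine hint.mono' (measurable_expDensity_mul_rpow W R C N).aestronglyMeasurable
    (.of_forall fun G => ?_)
  rw [Real.norm_of_nonneg (expDensity_mul_rpow_nonneg hW R C N G)]
  by_cases hG : G ∈ positiveMatrices m n
  · have hle : scalingInf G R C ≤ ∑ i, ∑ j, G i j := by
      simpa using scalingInf_le (R := R) (C := C) (fun i j => (hG i j).le) (x := 1) (y := 1)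
        (by simp) (by simp) (by simp) (by simp)
    have h0 := scalingInf_nonneg (R := R) (C := C) fun i j => (hG i j).le
    calc expDensity W G * scalingInf G R C ^ N
        ≤ expDensity W G * (K * Real.exp (ε * ∑ i, ∑ j, G i j)) :=
          mul_le_mul_of_nonneg_left
            ((Real.rpow_le_rpow h0 hle hN).trans (hKN _ (h0.trans hle))) (expDensity_nonneg hW G)
      _ = _ := by
          rw [mul_left_comm]
          congr 1
          simp only [expDensity, if_pos (hG _ _), Finset.mul_sum, Real.exp_sum,
            ← Finset.prod_mul_distrib]
          refine Finset.prod_congr rfl fun i _ => Finset.prod_congr rfl fun j _ => ?_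
          rw [mul_assoc, ← Real.exp_add]
          congr 2
          ring
  · rw [expDensity_of_notMem W hG, zero_mul]
    refine mul_nonneg hK (Finset.prod_nonneg fun i _ => Finset.prod_nonneg fun j _ => ?_)
    have := hW i j
    split_ifs <;> positivity

lemma expDensity_mul_rpow_rpow_mul_rpow_le {W : Fin m → Fin n → ℝ} (hW : ∀ i j, 0 < W i j) {N : ℝ}
    (hN : 0 ≤ N) (hR : ∑ i, R i = N) (hC : ∑ j, C j = N) (hR' : ∑ i, R' i = N)
    (hC' : ∑ j, C' j = N) {s t : ℝ} (hs : 0 < s) (ht : 0 < t) (hst : s + t = 1)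
    (G G' : Fin m → Fin n → ℝ) :
    (expDensity W G * scalingInf G R C ^ N) ^ s * (expDensity W G' * scalingInf G' R' C' ^ N) ^ t ≤
      expDensity W (s • G + t • G') *
        scalingInf (s • G + t • G') (s • R + t • R') (s • C + t • C') ^ N := by
  by_cases hG : G ∈ positiveMatrices m n
  swap
  · rw [expDensity_of_notMem W hG, zero_mul, Real.zero_rpow hs.ne', zero_mul]
    exact expDensity_mul_rpow_nonneg hW _ _ _ _
  by_cases hG' : G' ∈ positiveMatrices m n
  swap
  · rw [expDensity_of_notMem W hG', zero_mul, Real.zero_rpow ht.ne', mul_zero]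
    exact expDensity_mul_rpow_nonneg hW _ _ _ _
  have hG0 : ∀ i j, 0 ≤ G i j := fun i j => (hG i j).le
  have hG0' : ∀ i j, 0 ≤ G' i j := fun i j => (hG' i j).le
  rw [Real.mul_rpow (expDensity_nonneg hW G) (Real.rpow_nonneg (scalingInf_nonneg hG0) N),
    Real.mul_rpow (expDensity_nonneg hW G') (Real.rpow_nonneg (scalingInf_nonneg hG0') N),
    mul_mul_mul_comm, ← expDensity_smul_add_smul hW hG hG' hs ht hst]
  exact mul_le_mul_of_nonneg_left
    (rpow_scalingInf_rpow_mul_rpow_le hG0 hG0' hN hR hC hR' hC' hs.le ht.le hst)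
    (expDensity_nonneg hW _)

end scalingInf

theorem integral_scalingInf_pow_log_concave {m n p : ℕ}
    (W : Fin m → Fin n → ℝ) (hW : ∀ i j, 0 < W i j)
    (Rk : Fin p → Fin m → ℝ) (Ck : Fin p → Fin n → ℝ)
    (hR : ∀ k i, 0 < Rk k i) (hC : ∀ k j, 0 < Ck k j)
    (N : ℝ) (hRN : ∀ k, ∑ i, Rk k i = N) (hCN : ∀ k, ∑ j, Ck k j = N)
    (α : Fin p → ℝ) (hα : ∀ k, 0 ≤ α k) (hα1 : ∑ k, α k = 1) :
    (∫ G, scalingInf G (fun i => ∑ k, α k * Rk k i)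
        (fun j => ∑ k, α k * Ck k j) ^ N ∂(expMeasure W)) ≥
      ∏ k, (∫ G, scalingInf G (Rk k) (Ck k) ^ N ∂(expMeasure W)) ^ (α k) := by
  have hN : 0 ≤ N := by
    obtain ⟨k⟩ : Nonempty (Fin p) := by
      by_contra h
      rw [not_nonempty_iff] at h
      simp at hα1
    exact hRN k ▸ Finset.sum_nonneg fun i _ => (hR k i).le
  simp only [integral_expMeasure hW]
  have hD : Convex ℝ {q : (Fin m → ℝ) × (Fin n → ℝ) | ∑ i, q.1 i = N ∧ ∑ j, q.2 j = N} := by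
    rintro q ⟨hq1, hq2⟩ q' ⟨hq1', hq2'⟩ s t - - hst
    constructor
    · simp [Finset.sum_add_distrib, ← Finset.mul_sum, hq1, hq1', ← add_mul, hst]
    · simp [Finset.sum_add_distrib, ← Finset.mul_sum, hq2, hq2', ← add_mul, hst]
  have key := prod_rpow_le_of_rpow_mul_rpow_le hD
    (Φ := fun q => ∫ G, expDensity W G * scalingInf G q.1 q.2 ^ N)
    (fun q _ => integral_nonneg fun G => expDensity_mul_rpow_nonneg hW _ _ _ _)
    (fun q hq q' hq' s t hs ht hst =>
      ((satisfiesPrekopaLeindler_real.pi_fin n).pi_fin m).integral_rpow_mul_integral_rpow_le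
        hs ht hst (measurable_expDensity_mul_rpow _ _ _ _) (measurable_expDensity_mul_rpow _ _ _ _)
        (measurable_expDensity_mul_rpow _ _ _ _) (expDensity_mul_rpow_nonneg hW _ _ _)
        (expDensity_mul_rpow_nonneg hW _ _ _) (expDensity_mul_rpow_nonneg hW _ _ _)
        (integrable_expDensity_mul_rpow hW _ _ hN)
        (expDensity_mul_rpow_rpow_mul_rpow_le hW hN hq.1 hq.2 hq'.1 hq'.2 hs ht hst))
    Finset.univ (p := fun k => (Rk k, Ck k)) (fun k _ => hα k) hα1
    (fun k _ => ⟨hRN k, hCN k⟩)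
  have h1 : (∑ k, α k • (Rk k, Ck k)).1 = fun i => ∑ k, α k * Rk k i := by
    ext i
    simp [Prod.fst_sum]
  have h2 : (∑ k, α k • (Rk k, Ck k)).2 = fun j => ∑ k, α k * Ck k j := by
    ext j
    simp [Prod.snd_sum]
  simpa only [h1, h2] using key
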